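/- arXiv:2102.08670 — 2 statements merged into one kernel-verified Lean document; each statement's English description precedes it below -/
import Mathlib

section
/- Let S be a string of length n, let nss(i') = j' with j' ≤ n, let ℓ' = rlce(i', j') and d = j' − i'. Let i, j ∈ [1,n] satisfy nss(i) = j, j' < i, and j < j' + ℓ'. If nss(i − d) = j − d and (j − d) + rlce(i − d, j − d) ≥ i' + ℓ', then rlce(i,j) ≥ j' + ℓ' − j. -/
open List

variable {α : Type*} [LinearOrder α]

/-- The substring `S[i..j]` (1-based, both endpoints inclusive). -/
def sub (S : ℕ → α) (i j : ℕ) : List α := (List.range' i (j + 1 - i)).map S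

/-- The suffix `S_i = S[i..n]` (empty for `i = n + 1`). -/
def suf (S : ℕ → α) (n i : ℕ) : List α := sub S i n

/-- The prefix `S[1..i]`. -/
def pre (S : ℕ → α) (i : ℕ) : List α := sub S 1 i

/-- Strict lexicographic order `≺` on strings. -/
def slt (l₁ l₂ : List α) : Prop := List.Lex (· < ·) l₁ l₂

/-- Length of the longest common prefix of two lists. -/
def lcpLen (l₁ l₂ : List α) : ℕ :=
  Nat.findGreatest (fun k => l₁.take k = l₂.take k) (min l₁.length l₂.length)

/-- `rlce S n i j` : length of the longest common prefix of suffixes `S_i` and `S_j`. -/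
def rlce (S : ℕ → α) (n i j : ℕ) : ℕ := lcpLen (suf S n i) (suf S n j)

/-- `llce S i j` : length of the longest common suffix of prefixes `S[1..i]` and `S[1..j]`. -/
def llce (S : ℕ → α) (i j : ℕ) : ℕ := lcpLen (pre S i).reverse (pre S j).reverse

/-- Next-smaller-suffix array: `nss S n i = min { j | j = n+1 ∨ (i < j ≤ n ∧ S_j ≺ S_i) }`. -/
noncomputable def nss (S : ℕ → α) (n i : ℕ) : ℕ :=
  sInf {j | j = n + 1 ∨ (i < j ∧ j ≤ n ∧ slt (suf S n j) (suf S n i))}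

/-- A Lyndon word: nonempty and strictly smaller than each of its non-trivial cyclic shifts. -/
def IsLyndon (l : List α) : Prop :=
  l ≠ [] ∧ ∀ k, 0 < k → k < l.length → slt l (l.drop k ++ l.take k)

/-- The Lyndon array: `lyn S n i = max { j - i + 1 | i ≤ j ≤ n, S[i..j] is a Lyndon word }`. -/
noncomputable def lyn (S : ℕ → α) (n i : ℕ) : ℕ :=
  sSup {m | ∃ j, i ≤ j ∧ j ≤ n ∧ IsLyndon (sub S i j) ∧ m = j - i + 1}

/-- `p ≥ 1` is a period of `S[i..j]`: `S[x] = S[x+p]` for all `x ∈ [i, j - p]`. -/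
def IsPeriod (S : ℕ → α) (i j p : ℕ) : Prop :=
  1 ≤ p ∧ ∀ x, i ≤ x → x + p ≤ j → S x = S (x + p)

/-- A run `(i,j,p)` in a string of length `n`. -/
def IsRun (S : ℕ → α) (n i j p : ℕ) : Prop :=
  1 ≤ i ∧ i ≤ j ∧ j ≤ n ∧
  IsPeriod S i j p ∧ (∀ q, 1 ≤ q → q < p → ¬ IsPeriod S i j q) ∧
  2 * p ≤ j - i + 1 ∧
  (1 < i → ¬ IsPeriod S (i - 1) j p) ∧
  (j < n → ¬ IsPeriod S i (j + 1) p)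

/-- A (lexicographically) decreasing run: a run with `S_i ≻ S_{i+p}`. -/
def IsDecRun (S : ℕ → α) (n i j p : ℕ) : Prop :=
  IsRun S n i j p ∧ slt (suf S n (i + p)) (suf S n i)

lemma length_suf (S : ℕ → α) (n i : ℕ) : (suf S n i).length = n + 1 - i := by
  simp [suf, sub]

lemma take_suf_eq_take_suf_iff (S : ℕ → α) {n a b k : ℕ} (ha : k ≤ n + 1 - a)
    (hb : k ≤ n + 1 - b) :
    (suf S n a).take k = (suf S n b).take k ↔ ∀ t < k, S (a + t) = S (b + t) := by
  constructor
  · intro h t ht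
    have ht' := congrArg (fun l => l[t]?) h
    simpa [suf, sub, List.getElem?_take, ht, List.getElem?_range' (show t < n + 1 - a by omega),
      List.getElem?_range' (show t < n + 1 - b by omega)] using ht'
  · intro h
    apply List.ext_getElem
    · simp [length_suf]
      omega
    · intro t h₁ h₂
      have ht : t < k := by
        rw [List.length_take] at h₁
        omega
      simpa [suf, sub] using h t ht

lemma le_rlce_iff (S : ℕ → α) (n a b k : ℕ) :
    k ≤ rlce S n a b ↔
      k ≤ n + 1 - a ∧ k ≤ n + 1 - b ∧ ∀ t < k, S (a + t) = S (b + t) := by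
  have hlen : min (suf S n a).length (suf S n b).length = min (n + 1 - a) (n + 1 - b) := by
    simp only [length_suf]
  unfold rlce lcpLen
  rw [hlen]
  constructor
  · intro h
    set P : ℕ → Prop := fun k => (suf S n a).take k = (suf S n b).take k
    have hle := Nat.findGreatest_le (P := P) (min (n + 1 - a) (n + 1 - b))
    have hspec : P (Nat.findGreatest P (min (n + 1 - a) (n + 1 - b))) :=
      Nat.findGreatest_spec (m := 0) (Nat.zero_le _) (by simp [P])
    rw [le_min_iff] at hle
    have hS := (take_suf_eq_take_suf_iff S hle.1 hle.2).1 hspec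
    exact ⟨h.trans hle.1, h.trans hle.2, fun t ht => hS t (ht.trans_le h)⟩
  · rintro ⟨ha, hb, h⟩
    exact Nat.le_findGreatest (le_min ha hb) ((take_suf_eq_take_suf_iff S ha hb).2 h)

lemma lt_nss_of_nss_le (S : ℕ → α) {n i : ℕ} (h : nss S n i ≤ n) : i < nss S n i := by
  have hmem : nss S n i ∈
      {j | j = n + 1 ∨ (i < j ∧ j ≤ n ∧ slt (suf S n j) (suf S n i))} :=
    Nat.sInf_mem ⟨n + 1, Or.inl rfl⟩
  rcases hmem with h' | h'
  · omega
  · exact h'.1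

/-- Case R3c: With `nss(i') = j' ≤ n`, `ℓ' = rlce(i',j')`, `d = j' - i'`,
`nss(i) = j`, `j' < i`, `j < j' + ℓ'`: if `nss(i - d) = j - d` and
`(j - d) + rlce(i - d, j - d) ≥ i' + ℓ'`, then `rlce(i,j) ≥ j' + ℓ' - j`. -/
theorem stmt_14 (S : ℕ → α) (n i' j' ℓ' d i j : ℕ)
    (hi'1 : 1 ≤ i') (h1 : nss S n i' = j') (h2 : j' ≤ n)
    (hl : ℓ' = rlce S n i' j') (hd : d = j' - i')
    (hi1 : 1 ≤ i) (hi2 : i ≤ n) (hj1 : 1 ≤ j) (hj2 : j ≤ n)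
    (h3 : nss S n i = j) (h4 : j' < i) (h5 : j < j' + ℓ')
    (h6 : nss S n (i - d) = j - d)
    (h7 : i' + ℓ' ≤ (j - d) + rlce S n (i - d) (j - d)) :
    j' + ℓ' - j ≤ rlce S n i j := by
  have hi'j' : i' < j' := h1 ▸ lt_nss_of_nss_le S (h1.le.trans h2)
  have hij : i < j := h3 ▸ lt_nss_of_nss_le S (h3.le.trans hj2)
  obtain ⟨-, hl', hS'⟩ := (le_rlce_iff S n i' j' ℓ').1 hl.le
  obtain ⟨-, -, hS⟩ := (le_rlce_iff S n (i - d) (j - d) _).1 le_rfl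
  refine (le_rlce_iff S n i j _).2 ⟨by omega, by omega, fun t ht => ?_⟩
  have hi := hS' (i - j' + t) (by omega)
  have hj := hS' (j - j' + t) (by omega)
  have hij' := hS t (by omega)
  rw [show i' + (i - j' + t) = i - d + t by omega, show j' + (i - j' + t) = i + t by omega] at hi
  rw [show i' + (j - j' + t) = j - d + t by omega, show j' + (j - j' + t) = j + t by omega] at hj
  rw [← hi, hij', hj]
end

section
/- Let S be a string of length n and let i, j, i', j' ∈ [1,n] satisfy nss(i) = j, nss(i') = j', i < i', and llce(i', j') > i' − i. Then j ≤ i'. -/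
open List

variable {α : Type*} [LinearOrder α]

theorem slt_iff_lt (l₁ l₂ : List α) : slt l₁ l₂ ↔ l₁ < l₂ := Iff.rfl

theorem slt_append_left (w : List α) {l₁ l₂ : List α} (h : slt l₁ l₂) :
    slt (w ++ l₁) (w ++ l₂) :=
  List.Lex.append_left _ h w

theorem take_lcpLen (l₁ l₂ : List α) :
    l₁.take (lcpLen l₁ l₂) = l₂.take (lcpLen l₁ l₂) :=
  Nat.findGreatest_spec (P := fun k => l₁.take k = l₂.take k) (Nat.zero_le _) (by simp)

theorem lcpLen_le (l₁ l₂ : List α) : lcpLen l₁ l₂ ≤ min l₁.length l₂.length :=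
  Nat.findGreatest_le _

theorem pre_length {β : Type*} (S : ℕ → β) (i : ℕ) : (pre S i).length = i := by simp [pre, sub]

theorem getElem?_reverse_pre {β : Type*} (S : ℕ → β) {i t : ℕ} (h : t < i) :
    (pre S i).reverse[t]? = some (S (i - t)) := by
  rw [List.getElem?_reverse (by rwa [pre_length]), pre_length]
  simp only [pre, sub, List.getElem?_map]
  rw [List.getElem?_range' (by omega)]
  simp only [Option.map_some]
  congr 2
  omega

theorem llce_le (S : ℕ → α) (i j : ℕ) : llce S i j ≤ min i j := by
  simpa [llce, pre_length] using lcpLen_le (pre S i).reverse (pre S j).reverse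

theorem eq_of_lt_llce (S : ℕ → α) {i j t : ℕ} (h : t < llce S i j) : S (i - t) = S (j - t) := by
  have hle := llce_le S i j
  have key := congrArg (·[t]?) (take_lcpLen (pre S i).reverse (pre S j).reverse)
  change t < lcpLen _ _ at h
  simp only [List.getElem?_take_of_lt h] at key
  change t < llce S i j at h
  rwa [getElem?_reverse_pre S (by omega), getElem?_reverse_pre S (by omega),
    Option.some_inj] at key

theorem suf_add {β : Type*} (S : ℕ → β) {n i d : ℕ} (h : i + d ≤ n + 1) :
    suf S n i = (List.range' i d).map S ++ suf S n (i + d) := by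
  simp only [suf, sub]
  rw [← List.map_append, List.range'_append_1]
  congr 2
  omega

theorem nss_le {S : ℕ → α} {n i k : ℕ} (h : i < k) (hk : k ≤ n)
    (hs : slt (suf S n k) (suf S n i)) : nss S n i ≤ k :=
  Nat.sInf_le (Or.inr ⟨h, hk, hs⟩)

theorem nss_spec {S : ℕ → α} {n i : ℕ} (h : nss S n i ≤ n) :
    i < nss S n i ∧ slt (suf S n (nss S n i)) (suf S n i) := by
  have hmem : nss S n i ∈ {j | j = n + 1 ∨ (i < j ∧ j ≤ n ∧ slt (suf S n j) (suf S n i))} :=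
    Nat.sInf_mem ⟨n + 1, Or.inl rfl⟩
  rcases hmem with h' | ⟨h₁, -, h₂⟩
  · omega
  · exact ⟨h₁, h₂⟩

/-- If `nss(i) = j`, `nss(i') = j'`, `i < i'`, and `llce(i',j') > i' - i`,
then `j ≤ i'`. -/
theorem stmt_15 (S : ℕ → α) (n i j i' j' : ℕ)
    (hi1 : 1 ≤ i) (hi2 : i ≤ n) (hj1 : 1 ≤ j) (hj2 : j ≤ n)
    (hi'1 : 1 ≤ i') (hi'2 : i' ≤ n) (hj'1 : 1 ≤ j') (hj'2 : j' ≤ n)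
    (h1 : nss S n i = j) (h2 : nss S n i' = j')
    (h3 : i < i') (h4 : i' - i < llce S i' j') :
    j ≤ i' := by
  subst h1 h2
  obtain ⟨hlt, hs⟩ := nss_spec hj'2
  set j' := nss S n i' with hj'
  have hle := llce_le S i' j'
  obtain ⟨d, rfl⟩ := Nat.exists_eq_add_of_lt h3
  obtain ⟨k, hk⟩ : ∃ k, j' = k + (d + 1) := ⟨j' - (d + 1), by omega⟩
  have hw : (List.range' i (d + 1)).map S = (List.range' k (d + 1)).map S := by
    refine List.ext_getElem (by simp) fun t ht _ => ?_
    have ht' : t < d + 1 := by simpa using ht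
    have := eq_of_lt_llce S (i := i + d + 1) (j := j') (t := d + 1 - t) (by omega)
    rw [show i + d + 1 - (d + 1 - t) = i + t by omega,
      show j' - (d + 1 - t) = k + t by omega] at this
    simpa using this
  have hki : slt (suf S n k) (suf S n i) := by
    rw [suf_add S (i := i) (d := d + 1) (by omega), suf_add S (i := k) (d := d + 1) (by omega),
      hw, ← hk]
    exact slt_append_left _ hs
  rcases le_or_gt k (i + d + 1) with hk' | hk'
  · exact (nss_le (by omega) (by omega) hki).trans hk'
  · have hnot : ¬ slt (suf S n k) (suf S n (i + d + 1)) := fun h => by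
      have := nss_le hk' (by omega) h
      omega
    rw [slt_iff_lt, not_lt] at hnot
    exact nss_le h3 hi'2 (lt_of_le_of_lt hnot hki)
end
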